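/- arXiv:math/0601143 — 5 statements merged into one kernel-verified Lean document; each statement's English description precedes it below -/
import Mathlib

section
/- (Lemma 2 of [CF].) Let N be a positive integer and k an even positive integer. Suppose f : ℍ → ℂ satisfies f|_k H_N = ε f for some ε ∈ {1, -1}, and f|_k([[2,0],[0,1]]) + f|_k([[1,0],[0,2]]) + f|_k([[1,1],[0,2]]) = c f for some c ∈ ℂ. Then f|_k M_2 = f, where M_2 = [[2, -1], [-N, (N+1)/2]]. -/
open Complex UpperHalfPlane Matrix

/-- Möbius transform of `z ∈ ℍ` under a real 2×2 matrix, as a complex number. -/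
noncomputable def moebius (γ : Matrix (Fin 2) (Fin 2) ℝ) (z : ℍ) : ℂ :=
  ((γ 0 0 : ℂ) * (z : ℂ) + (γ 0 1 : ℂ)) / ((γ 1 0 : ℂ) * (z : ℂ) + (γ 1 1 : ℂ))

/-- Action of a real 2×2 matrix on the upper half-plane.  When the matrix has
positive determinant the Möbius image lies in `ℍ` and the `dite` takes the
first branch, so this agrees with the usual fractional linear action. -/
noncomputable def act (γ : Matrix (Fin 2) (Fin 2) ℝ) (z : ℍ) : ℍ :=
  if h : 0 < (moebius γ z).im then ⟨moebius γ z, h⟩ else z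

/-- Weight-`k` slash action `f ∣[k] γ` with the classical normalization
`(det γ)^(k/2) (cz+d)^(-k) f(γz)` (for `k` even, `det γ > 0`). -/
noncomputable def slash (k : ℤ) (γ : Matrix (Fin 2) (Fin 2) ℝ) (f : ℍ → ℂ) : ℍ → ℂ :=
  fun z => ((γ.det : ℂ) ^ (k / 2)) * (((γ 1 0 : ℂ) * (z : ℂ) + (γ 1 1 : ℂ)) ^ (-k)) * f (act γ z)

/-- The Hecke operator `T_n` (trivial character):
`f ∣[k] T_n = Σ_{ad = n, a,d > 0, 0 ≤ b < d} f ∣[k] [[a,b],[0,d]]`. -/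
noncomputable def hecke (k : ℤ) (n : ℕ) (f : ℍ → ℂ) : ℍ → ℂ :=
  fun z => ∑ a ∈ n.divisors, ∑ b ∈ Finset.range (n / a),
    slash k !![(a : ℝ), (b : ℝ); 0, ((n / a : ℕ) : ℝ)] f z

/-- The matrix `T = [[1,1],[0,1]]`. -/
noncomputable def Tmat : Matrix (Fin 2) (Fin 2) ℝ := !![1, 1; 0, 1]

/-- The Fricke matrix `H_N = [[0,-1],[N,0]]`. -/
noncomputable def Hmat (N : ℕ) : Matrix (Fin 2) (Fin 2) ℝ := !![0, -1; (N : ℝ), 0]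

/-- The matrix `W_N = [[1,0],[N,1]]`. -/
noncomputable def Wmat (N : ℕ) : Matrix (Fin 2) (Fin 2) ℝ := !![1, 0; (N : ℝ), 1]

/-- The matrix `β(x) = [[1,x],[0,1]]`. -/
noncomputable def betaMat (x : ℝ) : Matrix (Fin 2) (Fin 2) ℝ := !![1, x; 0, 1]

lemma denom_ne_zero_of_det_pos {γ : Matrix (Fin 2) (Fin 2) ℝ} (hγ : 0 < γ.det) (z : ℍ) :
    (γ 1 0 : ℂ) * (z : ℂ) + (γ 1 1 : ℂ) ≠ 0 := by
  intro h
  have him := congrArg Complex.im h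
  have hre := congrArg Complex.re h
  simp [z.im_ne_zero] at him
  simp [him] at hre
  simp [Matrix.det_fin_two, him, hre] at hγ

lemma im_moebius_eq (γ : Matrix (Fin 2) (Fin 2) ℝ) (z : ℍ) :
    (moebius γ z).im =
      γ.det * z.im / Complex.normSq ((γ 1 0 : ℂ) * (z : ℂ) + (γ 1 1 : ℂ)) := by
  simp only [moebius, Complex.div_im, Matrix.det_fin_two, ← sub_div]
  congr 1
  simp
  ring

lemma coe_act {γ : Matrix (Fin 2) (Fin 2) ℝ} (hγ : 0 < γ.det) (z : ℍ) :
    (act γ z : ℂ) = moebius γ z := by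
  have h : 0 < (moebius γ z).im := by
    rw [im_moebius_eq]
    exact div_pos (mul_pos hγ z.im_pos)
      (Complex.normSq_pos.2 (denom_ne_zero_of_det_pos hγ z))
  simp [act, h]

/-- The cocycle relation for the automorphy factor `cz + d`. -/
lemma denom_mul (γ : Matrix (Fin 2) (Fin 2) ℝ) {δ : Matrix (Fin 2) (Fin 2) ℝ}
    (hδ : 0 < δ.det) (z : ℍ) :
    ((γ * δ) 1 0 : ℂ) * (z : ℂ) + ((γ * δ) 1 1 : ℂ) =
      ((γ 1 0 : ℂ) * (act δ z : ℂ) + (γ 1 1 : ℂ)) *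
        ((δ 1 0 : ℂ) * (z : ℂ) + (δ 1 1 : ℂ)) := by
  have h := denom_ne_zero_of_det_pos hδ z
  rw [coe_act hδ, moebius, add_mul, mul_assoc, div_mul_cancel₀ _ h]
  simp only [Matrix.mul_apply, Fin.sum_univ_two]
  push_cast
  ring

lemma act_mul {γ δ : Matrix (Fin 2) (Fin 2) ℝ} (hγ : 0 < γ.det) (hδ : 0 < δ.det) (z : ℍ) :
    act (γ * δ) z = act γ (act δ z) := by
  have hγδ : 0 < (γ * δ).det := by rw [Matrix.det_mul]; exact mul_pos hγ hδ
  have h := denom_ne_zero_of_det_pos hδ z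
  ext1
  rw [coe_act hγδ, coe_act hγ, moebius, moebius, denom_mul γ hδ, ← div_div, div_right_comm]
  congr 1
  rw [div_eq_iff h, coe_act hδ, moebius, add_mul, mul_assoc, div_mul_cancel₀ _ h]
  simp only [Matrix.mul_apply, Fin.sum_univ_two]
  push_cast
  ring

lemma slash_mul (k : ℤ) {γ δ : Matrix (Fin 2) (Fin 2) ℝ} (hγ : 0 < γ.det) (hδ : 0 < δ.det)
    (f : ℍ → ℂ) : slash k (γ * δ) f = slash k δ (slash k γ f) := by
  funext z
  simp only [slash]
  rw [denom_mul γ hδ, act_mul hγ hδ, Matrix.det_mul, Complex.ofReal_mul, mul_zpow, mul_zpow]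
  ring

lemma slash_one (k : ℤ) (f : ℍ → ℂ) : slash k 1 f = f := by
  funext z
  have h : act 1 z = z := by
    ext1
    rw [coe_act (by simp)]
    simp [moebius]
  simp [slash, h]

lemma slash_add (k : ℤ) (γ : Matrix (Fin 2) (Fin 2) ℝ) (f g : ℍ → ℂ) :
    slash k γ (f + g) = slash k γ f + slash k γ g := by
  funext z
  simp [slash, mul_add]

lemma slash_smul (k : ℤ) (γ : Matrix (Fin 2) (Fin 2) ℝ) (c : ℂ) (f : ℍ → ℂ) :
    slash k γ (c • f) = c • slash k γ f := by
  funext z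
  simp only [slash, Pi.smul_apply, smul_eq_mul]
  ring

lemma slash_injective (k : ℤ) {γ : Matrix (Fin 2) (Fin 2) ℝ} (hγ : 0 < γ.det) :
    Function.Injective (slash k γ) := by
  have hinv : 0 < γ⁻¹.det := by
    rw [Matrix.det_nonsing_inv, Ring.inverse_eq_inv']
    exact inv_pos.2 hγ
  refine Function.LeftInverse.injective (g := slash k γ⁻¹) fun f => ?_
  rw [← slash_mul k hγ hinv, Matrix.mul_nonsing_inv γ hγ.ne'.isUnit, slash_one]


theorem hecke_two_gives_M2 (N : ℕ) (hN : 0 < N) (k : ℤ) (hk : 0 < k) (hke : Even k)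
    (f : ℍ → ℂ) (ε : ℂ) (hε : ε = 1 ∨ ε = -1) (c : ℂ)
    (hH : slash k (Hmat N) f = ε • f)
    (h2 : slash k !![(2 : ℝ), 0; 0, 1] f + slash k !![(1 : ℝ), 0; 0, 2] f
            + slash k !![(1 : ℝ), 1; 0, 2] f = c • f) :
    slash k !![(2 : ℝ), -1; -(N : ℝ), ((N : ℝ) + 1) / 2] f = f := by
  have hN' : (0 : ℝ) < N := by exact_mod_cast hN
  have detH : 0 < (Hmat N).det := by simpa [Hmat, Matrix.det_fin_two] using hN'
  have detA : 0 < (!![(2 : ℝ), 0; 0, 1]).det := by simp [Matrix.det_fin_two]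
  have detB : 0 < (!![(1 : ℝ), 0; 0, 2]).det := by simp [Matrix.det_fin_two]
  have detC : 0 < (!![(1 : ℝ), 1; 0, 2]).det := by simp [Matrix.det_fin_two]
  have detM : 0 < (!![(2 : ℝ), -1; -(N : ℝ), ((N : ℝ) + 1) / 2]).det := by
    rw [Matrix.det_fin_two_of]
    linarith
  have detCH : 0 < (!![(1 : ℝ), 1; 0, 2] * Hmat N).det := by
    rw [Matrix.det_mul]
    exact mul_pos detC detH
  have hAH : !![(2 : ℝ), 0; 0, 1] * Hmat N = Hmat N * !![(1 : ℝ), 0; 0, 2] := by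
    simp [Hmat]
  have hBH : !![(1 : ℝ), 0; 0, 2] * Hmat N = Hmat N * !![(2 : ℝ), 0; 0, 1] := by
    simp [Hmat, mul_comm]
  have hMCH : !![(2 : ℝ), -1; -(N : ℝ), ((N : ℝ) + 1) / 2] * (!![(1 : ℝ), 1; 0, 2] * Hmat N)
      = Hmat N * !![(1 : ℝ), 1; 0, 2] := by
    ext i j
    fin_cases i <;> fin_cases j <;> simp [Hmat] <;> ring
  have hA : slash k (Hmat N) (slash k !![(2 : ℝ), 0; 0, 1] f)
      = ε • slash k !![(1 : ℝ), 0; 0, 2] f := by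
    rw [← slash_mul k detA detH, hAH, slash_mul k detH detB, hH, slash_smul]
  have hB : slash k (Hmat N) (slash k !![(1 : ℝ), 0; 0, 2] f)
      = ε • slash k !![(2 : ℝ), 0; 0, 1] f := by
    rw [← slash_mul k detB detH, hBH, slash_mul k detH detA, hH, slash_smul]
  have hC : slash k (Hmat N) (slash k !![(1 : ℝ), 1; 0, 2] f)
      = ε • slash k !![(1 : ℝ), 1; 0, 2] f := by
    have h := congrArg (slash k (Hmat N)) h2
    rw [slash_add, slash_add, hA, hB, slash_smul, hH, smul_comm c ε f, ← h2, smul_add,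
      smul_add, add_comm (ε • slash k !![(1 : ℝ), 0; 0, 2] f)] at h
    exact add_left_cancel h
  apply slash_injective k detCH
  rw [← slash_mul k detM detCH, hMCH, slash_mul k detH detC, hH, slash_smul,
    slash_mul k detC detH, hC]
end

section
/- The group Γ₀(13) is generated by the five matrices T = [[1,1],[0,1]], W₁₃ = [[1,0],[13,1]], [[2,-1],[-13,7]], [[-3,-1],[13,4]], and [[3,-1],[13,-4]]; that is, the subgroup of SL(2,ℤ) generated by these five matrices equals Γ₀(13). -/
open Matrix
open scoped MatrixGroups

namespace GammaZeroThirteen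

open ModularGroup

/-- The lower triangular generator `W₁₃` of `Γ₀(13)`. -/
def genW : SL(2, ℤ) := ⟨!![1, 0; 13, 1], by simp⟩

/-- The hyperbolic generator of `Γ₀(13)`. -/
def genA : SL(2, ℤ) := ⟨!![2, -1; -13, 7], by simp⟩

/-- The generator of `Γ₀(13)` of order `6`. -/
def genB : SL(2, ℤ) := ⟨!![-3, -1; 13, 4], by simp⟩

/-- The generator of `Γ₀(13)` of order `3`. -/
def genC : SL(2, ℤ) := ⟨!![3, -1; 13, -4], by simp⟩

@[simp]
lemma coe_genW : (genW : Matrix (Fin 2) (Fin 2) ℤ) = !![1, 0; 13, 1] := rfl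

@[simp]
lemma coe_genA : (genA : Matrix (Fin 2) (Fin 2) ℤ) = !![2, -1; -13, 7] := rfl

@[simp]
lemma coe_genB : (genB : Matrix (Fin 2) (Fin 2) ℤ) = !![-3, -1; 13, 4] := rfl

@[simp]
lemma coe_genC : (genC : Matrix (Fin 2) (Fin 2) ℤ) = !![3, -1; 13, -4] := rfl

lemma genB_pow_three : genB ^ 3 = -1 := by
  apply Subtype.ext
  simp [pow_succ, one_fin_two]

lemma S_mul_S : S * S = -1 := by
  apply Subtype.ext
  simp [coe_S, one_fin_two]

lemma coe_S_mul_T_zpow_mul_S_inv (n : ℤ) :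
    ((S * T ^ n * S⁻¹ : SL(2, ℤ)) : Matrix (Fin 2) (Fin 2) ℤ) = !![1, 0; -n, 1] := by
  simp [coe_S, coe_T_zpow]

lemma S_mul_T_zpow_thirteen_mul (m : ℤ) : S * T ^ (13 * m) = genW ^ (-m) * S := by
  have h : S * T ^ (13 : ℤ) * S⁻¹ = genW⁻¹ := by
    apply Subtype.ext
    rw [coe_S_mul_T_zpow_mul_S_inv]
    simp
  rw [_root_.zpow_neg, ← _root_.inv_zpow, ← h, conj_zpow, _root_.zpow_mul]
  group

lemma S_mul_T_zpow_mul_S_eq {h : SL(2, ℤ)} {k j : ℤ}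
    (hh : (h : Matrix (Fin 2) (Fin 2) ℤ) = !![-j, -1; k * j + 1, k]) :
    S * T ^ k * S = h * (S * T ^ j) := by
  apply Subtype.ext
  simp [hh, coe_T_zpow, coe_S]

/-- If `H` contains the five generators, then every `S * T ^ r * S` with `|r| ≤ 6` lies in `H`
or in one of the cosets `H * (S * T ^ j)`. -/
lemma S_mul_T_zpow_mul_S_mem_of_abs_le {H : Subgroup SL(2, ℤ)} (hT : T ∈ H) (hW : genW ∈ H)
    (hA : genA ∈ H) (hB : genB ∈ H) (hC : genC ∈ H) {r : ℤ} (hr : -6 ≤ r) (hr' : r ≤ 6) :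
    S * T ^ r * S ∈ H ∨ ∃ j : ℤ, ∃ h ∈ H, S * T ^ r * S = h * (S * T ^ j) := by
  have hneg : -1 ∈ H := genB_pow_three ▸ pow_mem hB 3
  interval_cases r
  · refine Or.inr ⟨-2, genW * genA, mul_mem hW hA,
      S_mul_T_zpow_mul_S_eq ?_⟩
    simp
  · refine Or.inr ⟨-5, genW * genA * genC⁻¹, mul_mem (mul_mem hW hA) (inv_mem hC),
      S_mul_T_zpow_mul_S_eq ?_⟩
    simp
  · refine Or.inr ⟨-3, genC, hC,
      S_mul_T_zpow_mul_S_eq ?_⟩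
    simp
  · refine Or.inr ⟨-4, -1 * genC⁻¹, mul_mem hneg (inv_mem hC),
      S_mul_T_zpow_mul_S_eq ?_⟩
    simp
  · refine Or.inr ⟨-6, -1 * (genA⁻¹ * genW⁻¹), mul_mem hneg (mul_mem (inv_mem hA) (inv_mem hW)),
      S_mul_T_zpow_mul_S_eq ?_⟩
    simp
  · refine Or.inr ⟨1, -1 * T, mul_mem hneg hT,
      S_mul_T_zpow_mul_S_eq ?_⟩
    simp [coe_T]
  · exact Or.inl (by simpa [S_mul_S] using hneg)
  · refine Or.inr ⟨-1, T⁻¹, inv_mem hT,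
      S_mul_T_zpow_mul_S_eq ?_⟩
    simp [coe_T]
  · refine Or.inr ⟨6, T⁻¹ * genA⁻¹, mul_mem (inv_mem hT) (inv_mem hA),
      S_mul_T_zpow_mul_S_eq ?_⟩
    simp [coe_T]
  · refine Or.inr ⟨4, -1 * genB⁻¹, mul_mem hneg (inv_mem hB),
      S_mul_T_zpow_mul_S_eq ?_⟩
    simp
  · refine Or.inr ⟨3, genB, hB,
      S_mul_T_zpow_mul_S_eq ?_⟩
    simp
  · refine Or.inr ⟨5, genA * T * genB⁻¹, mul_mem (mul_mem hA hT) (inv_mem hB),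
      S_mul_T_zpow_mul_S_eq ?_⟩
    simp [coe_T]
  · refine Or.inr ⟨2, -1 * (genA * T), mul_mem hneg (mul_mem hA hT),
      S_mul_T_zpow_mul_S_eq ?_⟩
    simp [coe_T]

/-- If `H` contains the five generators, then `SL(2, ℤ)` is the union of `H` and the cosets
`H * (S * T ^ k)`. -/
lemma mem_or_exists_eq_mul_S_mul_T_zpow {H : Subgroup SL(2, ℤ)} (hT : T ∈ H) (hW : genW ∈ H)
    (hA : genA ∈ H) (hB : genB ∈ H) (hC : genC ∈ H) (g : SL(2, ℤ)) :
    g ∈ H ∨ ∃ k : ℤ, ∃ h ∈ H, g = h * (S * T ^ k) := by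
  have mul_S : ∀ x : SL(2, ℤ), (x ∈ H ∨ ∃ k : ℤ, ∃ h ∈ H, x = h * (S * T ^ k)) →
      (x * S ∈ H ∨ ∃ k : ℤ, ∃ h ∈ H, x * S = h * (S * T ^ k)) := by
    rintro x (hx | ⟨k, h, hh, rfl⟩)
    · exact Or.inr ⟨0, x, hx, by simp⟩
    · have key : h * (S * T ^ k) * S =
          h * genW ^ (-(k.bdiv 13)) * (S * T ^ (k.bmod 13) * S) := by
        conv_lhs => rw [← Int.bdiv_add_bmod k 13, _root_.zpow_add, ← mul_assoc S]
        rw [Nat.cast_ofNat, S_mul_T_zpow_thirteen_mul]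
        simp only [mul_assoc]
      have hmem : h * genW ^ (-(k.bdiv 13)) ∈ H := mul_mem hh (zpow_mem hW _)
      rw [key]
      rcases S_mul_T_zpow_mul_S_mem_of_abs_le hT hW hA hB hC (r := k.bmod 13)
        (by rw [Int.bmod_def]; lia) (by rw [Int.bmod_def]; lia) with hr | ⟨j, h', hh', hr⟩
      · exact Or.inl (mul_mem hmem hr)
      · exact Or.inr ⟨j, _, mul_mem hmem hh', by rw [hr, ← mul_assoc _ h']⟩
  have mul_T : ∀ (n : ℤ) (x : SL(2, ℤ)), (x ∈ H ∨ ∃ k : ℤ, ∃ h ∈ H, x = h * (S * T ^ k)) →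
      (x * T ^ n ∈ H ∨ ∃ k : ℤ, ∃ h ∈ H, x * T ^ n = h * (S * T ^ k)) := by
    rintro n x (hx | ⟨k, h, hh, rfl⟩)
    · exact Or.inl (mul_mem hx (zpow_mem hT n))
    · exact Or.inr ⟨k + n, h, hh, by simp only [_root_.zpow_add, mul_assoc]⟩
  have S_inv : S⁻¹ = S * S * S := by
    rw [inv_eq_iff_mul_eq_one, ← mul_assoc, ← mul_assoc, S_mul_S, mul_assoc, S_mul_S]
    simp
  have hg : g ∈ Subgroup.closure {S, T} := by
    rw [SpecialLinearGroup.SL2Z_generators]; trivial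
  induction hg using Subgroup.closure_induction_right with
  | one => exact Or.inl (one_mem H)
  | mul_right x hx y hy ih =>
    rcases hy with rfl | rfl
    · exact mul_S x ih
    · simpa using mul_T 1 x ih
  | mul_inv_cancel x hx y hy ih =>
    rcases hy with rfl | rfl
    · rw [S_inv, ← mul_assoc, ← mul_assoc]
      exact mul_S _ (mul_S _ (mul_S x ih))
    · simpa using mul_T (-1) x ih

lemma S_mul_T_zpow_notMem_Gamma0 (k : ℤ) : S * T ^ k ∉ CongruenceSubgroup.Gamma0 13 := by
  rw [CongruenceSubgroup.Gamma0_mem]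
  simp [coe_S, coe_T_zpow]
  decide

lemma eq_Gamma0_of_generators_mem {H : Subgroup SL(2, ℤ)} (hT : T ∈ H) (hW : genW ∈ H)
    (hA : genA ∈ H) (hB : genB ∈ H) (hC : genC ∈ H)
    (hH : H ≤ CongruenceSubgroup.Gamma0 13) : H = CongruenceSubgroup.Gamma0 13 := by
  refine le_antisymm hH fun g hg => ?_
  rcases mem_or_exists_eq_mul_S_mul_T_zpow hT hW hA hB hC g with h | ⟨k, h, hh, rfl⟩
  · exact h
  · exact absurd ((Subgroup.mul_mem_cancel_left _ (hH hh)).mp hg) (S_mul_T_zpow_notMem_Gamma0 k)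

end GammaZeroThirteen

open GammaZeroThirteen

/-- `Γ₀(13)` is generated by `T = [[1,1],[0,1]]`, `W₁₃ = [[1,0],[13,1]]`,
`[[2,-1],[-13,7]]`, `[[-3,-1],[13,4]]` and `[[3,-1],[13,-4]]`. -/
theorem gamma0_thirteen_generators :
    Subgroup.closure {g : SL(2, ℤ) |
        (g : Matrix (Fin 2) (Fin 2) ℤ) = !![1, 1; 0, 1] ∨
        (g : Matrix (Fin 2) (Fin 2) ℤ) = !![1, 0; 13, 1] ∨
        (g : Matrix (Fin 2) (Fin 2) ℤ) = !![2, -1; -13, 7] ∨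
        (g : Matrix (Fin 2) (Fin 2) ℤ) = !![-3, -1; 13, 4] ∨
        (g : Matrix (Fin 2) (Fin 2) ℤ) = !![3, -1; 13, -4]} =
      CongruenceSubgroup.Gamma0 13 := by
  apply eq_Gamma0_of_generators_mem
  · exact Subgroup.subset_closure (.inl ModularGroup.coe_T)
  · exact Subgroup.subset_closure (.inr (.inl rfl))
  · exact Subgroup.subset_closure (.inr (.inr (.inl rfl)))
  · exact Subgroup.subset_closure (.inr (.inr (.inr (.inl rfl))))
  · exact Subgroup.subset_closure (.inr (.inr (.inr (.inr rfl))))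
  · rw [Subgroup.closure_le]
    rintro g (hg | hg | hg | hg | hg) <;>
      simp only [SetLike.mem_coe, CongruenceSubgroup.Gamma0_mem, hg] <;> decide
end

section
/- The matrix E = [[1, −2/3], [11/2, −8/3]] lies in SL(2,ℝ) (its determinant is 1), is elliptic (its trace −5/3 satisfies (−5/3)² < 4), and has infinite order: for every integer n ≥ 1, Eⁿ is not a scalar matrix. Moreover E = [[4,1],[11,3]] · β(−1/2) · [[3,1],[11,4]] · β(−2/3), where β(x) = [[1,x],[0,1]]. -/
open Complex UpperHalfPlane Matrix

/-- If `3 E² = -5 E - 3`, then `3ⁿ Eⁿ⁺¹` is an integral combination of `E` and `1`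
in which the coefficient of `E` is congruent to `1` modulo `3`. -/
lemma exists_three_pow_smul_pow_succ_eq {A : Type*} [Ring A] [Algebra ℝ A] {E : A}
    (h : (3 : ℝ) • (E * E) = (-5 : ℝ) • E - (3 : ℝ) • (1 : A)) (n : ℕ) :
    ∃ a b : ℤ, (3 : ℝ) ^ n • E ^ (n + 1) = ((3 * a + 1 : ℤ) : ℝ) • E + (b : ℝ) • (1 : A) := by
  induction n with
  | zero => exact ⟨0, 0, by simp⟩
  | succ n ih =>
    obtain ⟨a, b, hab⟩ := ih
    refine ⟨-5 * a + b - 2, -3 * (3 * a + 1), ?_⟩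
    calc (3 : ℝ) ^ (n + 1) • E ^ (n + 1 + 1)
        = (3 : ℝ) • (((3 : ℝ) ^ n • E ^ (n + 1)) * E) := by
          rw [smul_mul_assoc, smul_smul, ← pow_succ, ← pow_succ']
      _ = ((3 * a + 1 : ℤ) : ℝ) • ((3 : ℝ) • (E * E)) + (3 * (b : ℝ)) • E := by
          rw [hab, add_mul, smul_mul_assoc, smul_mul_assoc, one_mul]
          module
      _ = _ := by
          rw [h]
          push_cast
          module

theorem elliptic_infinite_order_matrix (E : Matrix (Fin 2) (Fin 2) ℝ)
    (hE : E = !![1, -(2 / 3); 11 / 2, -(8 / 3)]) :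
    E.det = 1 ∧ E.trace = -(5 / 3) ∧ (-(5 / 3) : ℝ) ^ 2 < 4 ∧
      (∀ n : ℕ, 1 ≤ n → ¬∃ c : ℝ, E ^ n = c • (1 : Matrix (Fin 2) (Fin 2) ℝ)) ∧
      E = !![4, 1; 11, 3] * betaMat (-(1 / 2)) * !![3, 1; 11, 4] * betaMat (-(2 / 3)) := by
  refine ⟨?_, ?_, by norm_num, ?_, ?_⟩
  · rw [hE, Matrix.det_fin_two_of]
    norm_num
  · rw [hE, Matrix.trace_fin_two_of]
    norm_num
  · rintro n hn ⟨c, hc⟩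
    obtain ⟨m, rfl⟩ := Nat.exists_eq_add_of_le' hn
    have hquad : (3 : ℝ) • (E * E) =
        (-5 : ℝ) • E - (3 : ℝ) • (1 : Matrix (Fin 2) (Fin 2) ℝ) := by
      rw [hE]
      ext i j
      fin_cases i <;> fin_cases j <;> norm_num [Matrix.mul_apply, Fin.sum_univ_two]
    obtain ⟨a, b, hab⟩ := exists_three_pow_smul_pow_succ_eq hquad m
    rw [hc] at hab
    have hentry := congrFun (congrFun hab 1) 0
    have hzero : ((3 * a + 1 : ℤ) : ℝ) = 0 := by
      simpa [hE, -Int.cast_add, -Int.cast_mul] using hentry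
    have : 3 * a + 1 = 0 := by exact_mod_cast hzero
    omega
  · rw [hE]
    ext i j
    fin_cases i <;> fin_cases j <;>
      norm_num [betaMat, Matrix.mul_apply, Fin.sum_univ_two]
end

section
/- Let ε₁ = [[√13, 14/(3√13)], [−3√13, −√13]] and ε₂ = [[−√13, −4/√13], [7√13/2, √13]]. Then ε₁ε₂ = [[10/3, 2/3], [−13/2, −1]], which has determinant 1 and trace 7/3, hence is hyperbolic (trace squared exceeds 4 times the determinant). Moreover, every element of the subgroup of GL(2,ℝ) generated by ε₁ and ε₂ is of the form ±(ε₁ε₂)ⁿ or ±ε₂(ε₁ε₂)ⁿ for some integer n. -/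
open Matrix

/-- If `a² = b² = -1` in a group with a sign, every element of the subgroup generated by `a` and `b`
is of the form `±(ab)ⁿ` or `±b(ab)ⁿ`. -/
theorem exists_zpow_of_mem_closure_pair_of_mul_self_eq_neg_one {G : Type*} [Group G]
    [HasDistribNeg G] {a b : G} (ha : a * a = -1) (hb : b * b = -1) {g : G}
    (hg : g ∈ Subgroup.closure ({a, b} : Set G)) :
    ∃ n : ℤ, g = (a * b) ^ n ∨ g = -((a * b) ^ n) ∨
      g = b * (a * b) ^ n ∨ g = -(b * (a * b) ^ n) := by
  have neg_form : ∀ x : G,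
      (∃ n : ℤ, x = (a * b) ^ n ∨ x = -((a * b) ^ n) ∨
        x = b * (a * b) ^ n ∨ x = -(b * (a * b) ^ n)) →
      ∃ n : ℤ, -x = (a * b) ^ n ∨ -x = -((a * b) ^ n) ∨
        -x = b * (a * b) ^ n ∨ -x = -(b * (a * b) ^ n) := by
    rintro x ⟨n, rfl | rfl | rfl | rfl⟩ <;> exact ⟨n, by simp⟩
  have inv_eq : ∀ x : G, x * x = -1 → x⁻¹ = -x := fun x hx =>
    inv_eq_of_mul_eq_one_right (by rw [mul_neg, hx, neg_neg])
  have a_mul_zpow : ∀ n : ℤ, a * (a * b) ^ n = -(b * (a * b) ^ (n - 1)) := by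
    intro n
    have h : b * (a * b)⁻¹ = -a := by rw [_root_.mul_inv_rev, mul_inv_cancel_left, inv_eq a ha]
    rw [sub_eq_neg_add, _root_.zpow_add, _root_.zpow_neg_one, ← mul_assoc b, h, neg_mul, neg_neg]
  have a_mul_b_mul_zpow : ∀ n : ℤ, a * (b * (a * b) ^ n) = (a * b) ^ (n + 1) := by
    intro n
    rw [add_comm, _root_.zpow_add, zpow_one, mul_assoc a b]
  have b_mul_b_mul_zpow : ∀ n : ℤ, b * (b * (a * b) ^ n) = -((a * b) ^ n) := by
    intro n
    rw [← mul_assoc, hb, neg_mul, one_mul]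
  have mul_form : ∀ x ∈ ({a, b} : Set G), ∀ y : G,
      (∃ n : ℤ, y = (a * b) ^ n ∨ y = -((a * b) ^ n) ∨
        y = b * (a * b) ^ n ∨ y = -(b * (a * b) ^ n)) →
      ∃ n : ℤ, x * y = (a * b) ^ n ∨ x * y = -((a * b) ^ n) ∨
        x * y = b * (a * b) ^ n ∨ x * y = -(b * (a * b) ^ n) := by
    rintro x (rfl | rfl) y ⟨n, rfl | rfl | rfl | rfl⟩
    · exact ⟨n - 1, by simp only [a_mul_zpow, or_true]⟩
    · exact ⟨n - 1, by simp only [mul_neg, a_mul_zpow, neg_neg, true_or, or_true]⟩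
    · exact ⟨n + 1, by simp only [a_mul_b_mul_zpow, true_or]⟩
    · exact ⟨n + 1, by simp only [mul_neg, a_mul_b_mul_zpow, true_or, or_true]⟩
    · exact ⟨n, by simp only [true_or, or_true]⟩
    · exact ⟨n, by simp only [mul_neg, or_true]⟩
    · exact ⟨n, by simp only [b_mul_b_mul_zpow, true_or, or_true]⟩
    · exact ⟨n, by simp only [mul_neg, b_mul_b_mul_zpow, neg_neg, true_or]⟩
  induction hg using Subgroup.closure_induction_left with
  | one => exact ⟨0, by simp⟩
  | mul_left x hx y _ ih => exact mul_form x hx y ih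
  | inv_mul_cancel x hx y _ ih =>
    have hxx : x * x = -1 := by
      rcases hx with rfl | rfl
      exacts [ha, hb]
    rw [inv_eq x hxx, neg_mul]
    exact neg_form _ (mul_form x hx y ih)

theorem eps1_eps2_group (e₁ e₂ : GL (Fin 2) ℝ)
    (he₁ : (e₁ : Matrix (Fin 2) (Fin 2) ℝ) =
      !![Real.sqrt 13, 14 / (3 * Real.sqrt 13); -3 * Real.sqrt 13, -Real.sqrt 13])
    (he₂ : (e₂ : Matrix (Fin 2) (Fin 2) ℝ) =
      !![-Real.sqrt 13, -4 / Real.sqrt 13; 7 * Real.sqrt 13 / 2, Real.sqrt 13]) :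
    ((e₁ * e₂ : GL (Fin 2) ℝ) : Matrix (Fin 2) (Fin 2) ℝ) =
        !![10 / 3, 2 / 3; -(13 / 2), -1] ∧
      ((e₁ * e₂ : GL (Fin 2) ℝ) : Matrix (Fin 2) (Fin 2) ℝ).det = 1 ∧
      ((e₁ * e₂ : GL (Fin 2) ℝ) : Matrix (Fin 2) (Fin 2) ℝ).trace = 7 / 3 ∧
      ((e₁ * e₂ : GL (Fin 2) ℝ) : Matrix (Fin 2) (Fin 2) ℝ).trace ^ 2 >
        4 * ((e₁ * e₂ : GL (Fin 2) ℝ) : Matrix (Fin 2) (Fin 2) ℝ).det ∧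
      ∀ g ∈ Subgroup.closure ({e₁, e₂} : Set (GL (Fin 2) ℝ)), ∃ n : ℤ,
        g = (e₁ * e₂) ^ n ∨ g = -((e₁ * e₂) ^ n) ∨
        g = e₂ * (e₁ * e₂) ^ n ∨ g = -(e₂ * (e₁ * e₂) ^ n) := by
  have hs : √(13 : ℝ) * √13 = 13 := Real.mul_self_sqrt (by norm_num)
  have hs0 : √(13 : ℝ) ≠ 0 := by positivity
  have hprod : ((e₁ * e₂ : GL (Fin 2) ℝ) : Matrix (Fin 2) (Fin 2) ℝ) =
      !![10 / 3, 2 / 3; -(13 / 2), -1] := by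
    rw [Units.val_mul, he₁, he₂]
    ext i j
    fin_cases i <;> fin_cases j <;> simp [Matrix.mul_apply, Fin.sum_univ_two] <;>
      field_simp <;> grind
  have h₁ : e₁ * e₁ = -1 := by
    ext i j
    rw [Units.val_mul, he₁]
    fin_cases i <;> fin_cases j <;> simp [Matrix.mul_apply, Fin.sum_univ_two] <;>
      field_simp <;> grind
  have h₂ : e₂ * e₂ = -1 := by
    ext i j
    rw [Units.val_mul, he₂]
    fin_cases i <;> fin_cases j <;> simp [Matrix.mul_apply, Fin.sum_univ_two] <;>
      field_simp <;> grind
  have hdet : ((e₁ * e₂ : GL (Fin 2) ℝ) : Matrix (Fin 2) (Fin 2) ℝ).det = 1 := by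
    rw [hprod, Matrix.det_fin_two_of]
    norm_num
  have htrace : ((e₁ * e₂ : GL (Fin 2) ℝ) : Matrix (Fin 2) (Fin 2) ℝ).trace = 7 / 3 := by
    rw [hprod, Matrix.trace_fin_two_of]
    norm_num
  refine ⟨hprod, hdet, htrace, ?_, fun g hg =>
    exists_zpow_of_mem_closure_pair_of_mul_self_eq_neg_one h₁ h₂ hg⟩
  rw [hdet, htrace]
  norm_num
end

section
/- Let N be a positive integer. Every element of Γ₀(N), viewed as a matrix in GL(2,ℝ), is a positive real scalar multiple of an element of the subgroup of GL(2,ℝ) generated by T = [[1,1],[0,1]] and H_N = [[0,-1],[N,0]], if and only if N ≤ 4. -/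
open Matrix
open scoped MatrixGroups

/-- The translation matrix `[[1,k],[0,1]]`. -/
def translationMatrix (k : ℤ) : Matrix (Fin 2) (Fin 2) ℝ := !![1, (k : ℝ); 0, 1]

/-- The Fricke matrix `[[0,-1],[N,0]]`. -/
def frickeMatrix (N : ℕ) : Matrix (Fin 2) (Fin 2) ℝ := !![0, -1; (N : ℝ), 0]

theorem translationMatrix_mul (j k : ℤ) :
    translationMatrix j * translationMatrix k = translationMatrix (j + k) := by
  ext i l
  fin_cases i <;> fin_cases l <;> simp [translationMatrix, add_comm]

theorem translationMatrix_zero : translationMatrix 0 = 1 := by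
  ext i l
  fin_cases i <;> fin_cases l <;> simp [translationMatrix]

theorem frickeMatrix_mul_self (N : ℕ) :
    frickeMatrix N * frickeMatrix N = (-(N : ℝ)) • (1 : Matrix (Fin 2) (Fin 2) ℝ) := by
  ext i l
  fin_cases i <;> fin_cases l <;> simp [frickeMatrix]

theorem coe_inv_of_coe_eq_translationMatrix {t : GL (Fin 2) ℝ}
    (ht : (t : Matrix (Fin 2) (Fin 2) ℝ) = translationMatrix 1) :
    ((t⁻¹ : GL (Fin 2) ℝ) : Matrix (Fin 2) (Fin 2) ℝ) = translationMatrix (-1) := by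
  rw [Units.inv_eq_of_mul_eq_one_right]
  rw [ht, translationMatrix_mul, add_neg_cancel, translationMatrix_zero]

theorem coe_inv_of_coe_eq_frickeMatrix {N : ℕ} (hN : 0 < N) {h : GL (Fin 2) ℝ}
    (hh : (h : Matrix (Fin 2) (Fin 2) ℝ) = frickeMatrix N) :
    ((h⁻¹ : GL (Fin 2) ℝ) : Matrix (Fin 2) (Fin 2) ℝ) = (-(N : ℝ)⁻¹) • frickeMatrix N := by
  have hN' : (N : ℝ) ≠ 0 := by positivity
  rw [Units.inv_eq_of_mul_eq_one_right]
  rw [hh, mul_smul_comm, frickeMatrix_mul_self, smul_smul, neg_mul_neg, inv_mul_cancel₀ hN',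
    one_smul]

/-! ### Positive multiples of the elements of a subgroup -/

/-- The matrices that are positive scalar multiples of elements of `G`. -/
def positiveMultiples (G : Subgroup (GL (Fin 2) ℝ)) : Set (Matrix (Fin 2) (Fin 2) ℝ) :=
  {M | ∃ c : ℝ, 0 < c ∧ ∃ u ∈ G, M = c • (u : Matrix (Fin 2) (Fin 2) ℝ)}

section PositiveMultiples

variable {G : Subgroup (GL (Fin 2) ℝ)} {M M' : Matrix (Fin 2) (Fin 2) ℝ}

theorem coe_mem_positiveMultiples {u : GL (Fin 2) ℝ} (hu : u ∈ G) :
    (u : Matrix (Fin 2) (Fin 2) ℝ) ∈ positiveMultiples G :=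
  ⟨1, one_pos, u, hu, (one_smul _ _).symm⟩

theorem mul_mem_positiveMultiples (hM : M ∈ positiveMultiples G)
    (hM' : M' ∈ positiveMultiples G) : M * M' ∈ positiveMultiples G := by
  obtain ⟨c, hc, u, hu, rfl⟩ := hM
  obtain ⟨c', hc', u', hu', rfl⟩ := hM'
  exact ⟨c * c', mul_pos hc hc', u * u', mul_mem hu hu', by
    rw [Units.val_mul, smul_mul_smul_comm]⟩

theorem smul_mem_positiveMultiples {s : ℝ} (hs : 0 < s) (hM : M ∈ positiveMultiples G) :
    s • M ∈ positiveMultiples G := by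
  obtain ⟨c, hc, u, hu, rfl⟩ := hM
  exact ⟨s * c, mul_pos hs hc, u, hu, smul_smul _ _ _⟩

theorem neg_mem_positiveMultiples {N : ℕ} (hN : 0 < N)
    (hF : frickeMatrix N ∈ positiveMultiples G) (hM : M ∈ positiveMultiples G) :
    -M ∈ positiveMultiples G := by
  have hN' : (0 : ℝ) < N := by exact_mod_cast hN
  have h := smul_mem_positiveMultiples (inv_pos.mpr hN')
    (mul_mem_positiveMultiples (mul_mem_positiveMultiples hF hF) hM)
  rwa [frickeMatrix_mul_self, smul_mul_assoc, one_mul, smul_smul, mul_neg,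
    inv_mul_cancel₀ hN'.ne', neg_one_smul] at h

theorem translationMatrix_mem_positiveMultiples {t : GL (Fin 2) ℝ} (htG : t ∈ G)
    (ht : (t : Matrix (Fin 2) (Fin 2) ℝ) = translationMatrix 1) (k : ℤ) :
    translationMatrix k ∈ positiveMultiples G := by
  induction k with
  | zero =>
    rw [translationMatrix_zero]
    exact coe_mem_positiveMultiples (one_mem G)
  | succ k ih =>
    rw [← translationMatrix_mul, ← ht]
    exact mul_mem_positiveMultiples ih (coe_mem_positiveMultiples htG)
  | pred k ih =>
    rw [sub_eq_add_neg, ← translationMatrix_mul, ← coe_inv_of_coe_eq_translationMatrix ht]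
    exact mul_mem_positiveMultiples ih (coe_mem_positiveMultiples (inv_mem htG))

end PositiveMultiples

/-! ### The descent for `N ≤ 4` -/

theorem exists_two_mul_abs_add_mul_le (a m : ℤ) (hm : m ≠ 0) :
    ∃ k : ℤ, 2 * |a + k * m| ≤ |m| := by
  have h0 := Int.emod_nonneg a hm
  have h1 := Int.emod_lt_abs a hm
  have h2 := Int.emod_add_mul_ediv a m
  by_cases h : 2 * (a % m) ≤ |m|
  · refine ⟨-(a / m), ?_⟩
    rw [show a + -(a / m) * m = a % m by linarith, abs_of_nonneg h0]
    exact h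
  · refine ⟨-(a / m) - m.sign, ?_⟩
    rw [show a + (-(a / m) - m.sign) * m = a % m - |m| by
      linarith [Int.sign_mul_self_eq_abs m], abs_of_nonpos (by linarith)]
    linarith

theorem mem_positiveMultiples_of_le_four {G : Subgroup (GL (Fin 2) ℝ)} {N : ℕ} (hN : 0 < N)
    (hN4 : N ≤ 4) (hT : ∀ k, translationMatrix k ∈ positiveMultiples G)
    (hF : frickeMatrix N ∈ positiveMultiples G) (a b c d : ℤ) (hdet : a * d - b * (N * c) = 1) :
    (!![(a : ℝ), b; N * c, d] : Matrix (Fin 2) (Fin 2) ℝ) ∈ positiveMultiples G := by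
  induction hn : c.natAbs using Nat.strong_induction_on generalizing a b c d with
  | _ n ih =>
  subst hn
  have hNR : (0 : ℝ) < N := by exact_mod_cast hN
  by_cases hc : c = 0
  · subst hc
    have had : a * d = 1 := by linarith
    rcases Int.mul_eq_one_iff_eq_one_or_neg_one.mp had with ⟨rfl, rfl⟩ | ⟨rfl, rfl⟩
    · simpa [translationMatrix] using hT b
    · simpa [translationMatrix] using neg_mem_positiveMultiples hN hF (hT (-b))
  have hm : (N : ℤ) * c ≠ 0 := mul_ne_zero (by exact_mod_cast hN.ne') hc
  obtain ⟨k, hk⟩ := exists_two_mul_abs_add_mul_le a (N * c) hm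
  obtain ⟨a₁, rfl⟩ : ∃ a₁, a = a₁ - k * (N * c) := ⟨a + k * (N * c), by ring⟩
  obtain ⟨b₁, rfl⟩ : ∃ b₁, b = b₁ - k * d := ⟨b + k * d, by ring⟩
  rw [sub_add_cancel, abs_mul, Nat.abs_cast] at hk
  have hdet' : a₁ * d - b₁ * (N * c) = 1 := by linarith
  by_cases ha : a₁ = 0
  · subst ha
    have hmem := mul_mem_positiveMultiples (hT (-k)) (mul_mem_positiveMultiples hF (hT (-b₁ * d)))
    obtain rfl : N = 1 := by
      have : (N : ℤ) ∣ 1 := ⟨c * -b₁, by linarith⟩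
      exact_mod_cast Int.eq_one_of_dvd_one (by positivity) this
    rw [Nat.cast_one] at hdet'
    rcases Int.mul_eq_one_iff_eq_one_or_neg_one.mp (by linarith : c * -b₁ = 1) with
      ⟨rfl, hb⟩ | ⟨rfl, hb⟩
    · obtain rfl : b₁ = -1 := by linarith
      convert hmem using 1
      ext i j
      fin_cases i <;> fin_cases j <;> simp [translationMatrix, frickeMatrix] <;> ring
    · obtain rfl : b₁ = 1 := by linarith
      convert neg_mem_positiveMultiples hN hF hmem using 1
      ext i j
      fin_cases i <;> fin_cases j <;> simp [translationMatrix, frickeMatrix] <;> ring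
  obtain ⟨l, hl⟩ := exists_two_mul_abs_add_mul_le (-c) a₁ ha
  have hlt : (-c + l * a₁).natAbs < c.natAbs := by
    zify
    have hcpos : 0 < |c| := abs_pos.mpr hc
    rcases Nat.lt_or_ge N 4 with h | h
    · have : (N : ℤ) * |c| ≤ 3 * |c| := by
        gcongr
        exact_mod_cast Nat.le_of_lt_succ h
      linarith
    · obtain rfl : N = 4 := le_antisymm hN4 h
      push_cast at hk hdet'
      have hne : |a₁| ≠ 2 * |c| := by
        intro h
        have h2 : (2 : ℤ) ∣ a₁ := by
          rw [← dvd_abs, h]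
          exact dvd_mul_right _ _
        obtain ⟨e, rfl⟩ := h2
        have : 2 * (e * d - b₁ * 2 * c) = 1 := by linarith
        omega
      have : |a₁| < 2 * |c| := lt_of_le_of_ne (by linarith) hne
      linarith
  have hrec := ih _ hlt (-a₁) (-b₁) (-c + l * a₁) (-d + l * (N * b₁))
    (by linear_combination hdet') rfl
  have hmem := smul_mem_positiveMultiples (inv_pos.mpr hNR)
    (mul_mem_positiveMultiples (hT (-k)) (mul_mem_positiveMultiples hF
      (mul_mem_positiveMultiples (hT (-l)) (mul_mem_positiveMultiples hF hrec))))
  convert hmem using 1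
  ext i j
  fin_cases i <;> fin_cases j <;>
    simp [translationMatrix, frickeMatrix] <;> field_simp <;> ring

/-! ### Reduced words and ping-pong for `5 ≤ N` -/

/-- Nonzero multiples of reduced words in the translations and the Fricke matrix that begin with
the Fricke matrix. -/
inductive IsReducedWord (N : ℕ) : Matrix (Fin 2) (Fin 2) ℝ → Prop
  | base (s : ℝ) (hs : s ≠ 0) (k : ℤ) : IsReducedWord N (s • (frickeMatrix N * translationMatrix k))
  | step (s : ℝ) (hs : s ≠ 0) (k : ℤ) (hk : k ≠ 0) (M : Matrix (Fin 2) (Fin 2) ℝ)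
      (hM : IsReducedWord N M) :
      IsReducedWord N (s • (frickeMatrix N * (translationMatrix k * M)))

/-- Nonzero multiples of a translation or of a translation times a reduced word. -/
def HasNormalForm (N : ℕ) (M : Matrix (Fin 2) (Fin 2) ℝ) : Prop :=
  (∃ s : ℝ, s ≠ 0 ∧ ∃ k : ℤ, M = s • translationMatrix k) ∨
    ∃ s : ℝ, s ≠ 0 ∧ ∃ k : ℤ, ∃ M', IsReducedWord N M' ∧ M = s • (translationMatrix k * M')

namespace HasNormalForm

variable {N : ℕ} {M : Matrix (Fin 2) (Fin 2) ℝ}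

theorem smul {s : ℝ} (hs : s ≠ 0) (hM : HasNormalForm N M) : HasNormalForm N (s • M) := by
  rcases hM with ⟨r, hr, k, rfl⟩ | ⟨r, hr, k, M', hM', rfl⟩
  · exact Or.inl ⟨s * r, mul_ne_zero hs hr, k, smul_smul _ _ _⟩
  · exact Or.inr ⟨s * r, mul_ne_zero hs hr, k, M', hM', smul_smul _ _ _⟩

theorem translationMatrix_mul_left (j : ℤ) (hM : HasNormalForm N M) :
    HasNormalForm N (translationMatrix j * M) := by
  rcases hM with ⟨r, hr, k, rfl⟩ | ⟨r, hr, k, M', hM', rfl⟩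
  · exact Or.inl ⟨r, hr, j + k, by rw [mul_smul_comm, translationMatrix_mul]⟩
  · exact Or.inr ⟨r, hr, j + k, M', hM', by
      rw [mul_smul_comm, ← mul_assoc, translationMatrix_mul]⟩

theorem of_isReducedWord (hM : IsReducedWord N M) : HasNormalForm N M :=
  Or.inr ⟨1, one_ne_zero, 0, M, hM, by rw [translationMatrix_zero, one_mul, one_smul]⟩

theorem frickeMatrix_mul_left (hN : 0 < N) (hM : HasNormalForm N M) :
    HasNormalForm N (frickeMatrix N * M) := by
  have hN' : -(N : ℝ) ≠ 0 := neg_ne_zero.mpr (by positivity)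
  rcases hM with ⟨r, hr, k, rfl⟩ | ⟨r, hr, k, M', hM', rfl⟩
  · rw [mul_smul_comm]
    exact of_isReducedWord (.base r hr k)
  · rw [mul_smul_comm]
    by_cases hk : k = 0
    · subst hk
      rw [translationMatrix_zero, one_mul]
      refine smul hr ?_
      cases hM' with
      | base s hs j =>
        rw [mul_smul_comm, ← mul_assoc, frickeMatrix_mul_self, smul_mul_assoc, one_mul]
        exact smul hs (Or.inl ⟨_, hN', j, rfl⟩)
      | step s hs j hj M hM =>
        rw [mul_smul_comm, ← mul_assoc, frickeMatrix_mul_self, smul_mul_assoc, one_mul]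
        exact smul hs (Or.inr ⟨_, hN', j, M, hM, rfl⟩)
    · exact of_isReducedWord (.step r hr k hk M' hM')

theorem of_mem_closure (hN : 0 < N) {t h u : GL (Fin 2) ℝ}
    (ht : (t : Matrix (Fin 2) (Fin 2) ℝ) = translationMatrix 1)
    (hh : (h : Matrix (Fin 2) (Fin 2) ℝ) = frickeMatrix N)
    (hu : u ∈ Subgroup.closure ({t, h} : Set (GL (Fin 2) ℝ))) :
    HasNormalForm N (u : Matrix (Fin 2) (Fin 2) ℝ) := by
  induction hu using Subgroup.closure_induction_left with
  | one => exact Or.inl ⟨1, one_ne_zero, 0, by simp [translationMatrix_zero]⟩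
  | mul_left x hx y _ ih =>
    rw [Units.val_mul]
    rcases hx with rfl | rfl
    · rw [ht]
      exact ih.translationMatrix_mul_left 1
    · rw [hh]
      exact ih.frickeMatrix_mul_left hN
  | inv_mul_cancel x hx y _ ih =>
    rw [Units.val_mul]
    rcases hx with rfl | rfl
    · rw [coe_inv_of_coe_eq_translationMatrix ht]
      exact ih.translationMatrix_mul_left (-1)
    · rw [coe_inv_of_coe_eq_frickeMatrix hN hh, smul_mul_assoc]
      exact (ih.frickeMatrix_mul_left hN).smul (neg_ne_zero.mpr (inv_ne_zero (by positivity)))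

end HasNormalForm

theorem frickeMatrix_mul_translationMatrix_mulVec (N : ℕ) (s : ℝ) (k : ℤ) (v : Fin 2 → ℝ) :
    (s • (frickeMatrix N * translationMatrix k)) *ᵥ v =
      ![-(s * v 1), s * (N * (v 0 + k * v 1))] := by
  ext i
  fin_cases i <;>
    simp [frickeMatrix, translationMatrix, Matrix.mulVec, dotProduct, Fin.sum_univ_two]
  ring

theorem sq_lt_four_mul_add_int_mul_sq {p q : ℝ} {k : ℤ} (hk : k ≠ 0) (h : 4 * p ^ 2 < q ^ 2) :
    q ^ 2 < 4 * (p + k * q) ^ 2 := by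
  have hk1 : (1 : ℝ) ≤ |(k : ℝ)| := by exact_mod_cast Int.one_le_abs hk
  have h1 : 2 * |p| < |q| := by
    have : |2 * p| < |q| := sq_lt_sq.mp (by linarith)
    rwa [abs_mul, abs_two] at this
  have h2 : |(k : ℝ) * q| ≤ |p + k * q| + |p| := by
    simpa using abs_sub (p + k * q) p
  rw [abs_mul] at h2
  have h3 : |q| ≤ |(k : ℝ)| * |q| := le_mul_of_one_le_left (abs_nonneg q) hk1
  have : |q| < |2 * (p + k * q)| := by
    rw [abs_mul, abs_two]
    linarith
  linarith [sq_lt_sq.mpr this]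

theorem one_le_one_add_int_mul_two_sq (k : ℤ) : (1 : ℝ) ≤ (1 + k * 2) ^ 2 := by
  have h : 0 < (1 + k * 2) ^ 2 := sq_pos_of_ne_zero (by omega)
  exact_mod_cast Int.add_one_le_iff.mpr h

/-- A reduced word moves the point `1/2` into the isometric circle of the Fricke matrix. -/
theorem IsReducedWord.mulVec_sq_lt {N : ℕ} (hN : 5 ≤ N) {M : Matrix (Fin 2) (Fin 2) ℝ}
    (hM : IsReducedWord N M) :
    (N : ℝ) * (M *ᵥ ![1, 2]) 0 ^ 2 < (M *ᵥ ![1, 2]) 1 ^ 2 := by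
  have hN' : (5 : ℝ) ≤ N := by exact_mod_cast hN
  have key : ∀ s x y : ℝ, s ≠ 0 → y ^ 2 < N * x ^ 2 →
      (N : ℝ) * (-(s * y)) ^ 2 < (s * (N * x)) ^ 2 := by
    intro s x y hs h
    have : 0 < N * s ^ 2 * (N * x ^ 2 - y ^ 2) :=
      mul_pos (by positivity) (sub_pos.mpr h)
    linarith
  induction hM with
  | base s hs k =>
    rw [frickeMatrix_mul_translationMatrix_mulVec]
    refine key s _ _ hs ?_
    have h1 := one_le_one_add_int_mul_two_sq k
    simp only [Matrix.cons_val_zero, Matrix.cons_val_one]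
    nlinarith
  | step s hs k hk M _ ih =>
    rw [← mul_assoc, ← smul_mul_assoc, ← Matrix.mulVec_mulVec,
      frickeMatrix_mul_translationMatrix_mulVec]
    refine key s _ _ hs ?_
    refine (sq_lt_four_mul_add_int_mul_sq (p := (M *ᵥ ![1, 2]) 0) hk
      (lt_of_le_of_lt ?_ ih)).trans_le ?_ <;> gcongr <;> linarith

/-- A parabolic matrix fixing `1/2` is not a multiple of a word when `5 ≤ N`. -/
theorem not_hasNormalForm_of_mulVec_eq {N : ℕ} (hN : 5 ≤ N) {M : Matrix (Fin 2) (Fin 2) ℝ}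
    (hM : M *ᵥ ![1, 2] = ![1, 2]) (hM10 : M 1 0 ≠ 0) : ¬ HasNormalForm N M := by
  have hN' : (5 : ℝ) ≤ N := by exact_mod_cast hN
  rintro (⟨s, hs, k, rfl⟩ | ⟨s, hs, k, M', hM', rfl⟩)
  · simp [translationMatrix] at hM10
  · have hlt := hM'.mulVec_sq_lt hN
    rw [Matrix.smul_mulVec, ← Matrix.mulVec_mulVec] at hM
    set v := M' *ᵥ ![1, 2]
    have h0 : s * (v 0 + k * v 1) = 1 := by
      simpa [translationMatrix, Matrix.mulVec, dotProduct, Fin.sum_univ_two] using congrFun hM 0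
    have h1 : s * v 1 = 2 := by
      simpa [translationMatrix, Matrix.mulVec, dotProduct, Fin.sum_univ_two] using congrFun hM 1
    have hv : s * v 0 = 1 - 2 * k := by linear_combination h0 - k * h1
    have h2 := one_le_one_add_int_mul_two_sq (-k)
    push_cast at h2
    have h3 : (N : ℝ) * (s * v 0) ^ 2 < (s * v 1) ^ 2 := by
      have : 0 < s ^ 2 * (v 1 ^ 2 - N * v 0 ^ 2) := mul_pos (by positivity) (sub_pos.mpr hlt)
      linarith
    rw [hv, h1] at h3
    nlinarith

/-- Every element of `Γ₀(N)`, viewed in `GL(2,ℝ)`, is a positive scalar multiple of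
an element of the subgroup of `GL(2,ℝ)` generated by `T = [[1,1],[0,1]]` and
`H_N = [[0,-1],[N,0]]`, if and only if `N ≤ 4`. -/
theorem gamma0_in_group_of_T_and_fricke_iff (N : ℕ) (hN : 0 < N)
    (tGL hGL : GL (Fin 2) ℝ)
    (ht : (tGL : Matrix (Fin 2) (Fin 2) ℝ) = !![1, 1; 0, 1])
    (hh : (hGL : Matrix (Fin 2) (Fin 2) ℝ) = !![0, -1; (N : ℝ), 0]) :
    (∀ g ∈ CongruenceSubgroup.Gamma0 N,
        ∃ c : ℝ, 0 < c ∧ ∃ u ∈ Subgroup.closure ({tGL, hGL} : Set (GL (Fin 2) ℝ)),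
          ((g : Matrix (Fin 2) (Fin 2) ℤ)).map (fun m : ℤ => (m : ℝ)) =
            c • ((u : GL (Fin 2) ℝ) : Matrix (Fin 2) (Fin 2) ℝ)) ↔
      N ≤ 4 := by
  have ht' : (tGL : Matrix (Fin 2) (Fin 2) ℝ) = translationMatrix 1 := by
    simp [ht, translationMatrix]
  have hh' : (hGL : Matrix (Fin 2) (Fin 2) ℝ) = frickeMatrix N := hh
  constructor
  · intro h
    by_contra! hN5
    let g : SL(2, ℤ) := ⟨!![1 - 2 * (N : ℤ), N; -4 * N, 1 + 2 * N], by
      rw [Matrix.det_fin_two_of]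
      ring⟩
    have hg : g ∈ CongruenceSubgroup.Gamma0 N := by
      rw [CongruenceSubgroup.Gamma0_mem]
      simp [g]
    obtain ⟨c, hc, u, hu, hgu⟩ := h g hg
    refine not_hasNormalForm_of_mulVec_eq hN5 ?_ ?_
      ((HasNormalForm.of_mem_closure hN ht' hh' hu).smul hc.ne')
    · rw [← hgu]
      ext i
      fin_cases i <;>
        simp [g, Matrix.mulVec, dotProduct, Fin.sum_univ_two] <;> ring
    · rw [← hgu]
      simp [g, hN.ne']
  · intro hN4 g hg
    have hT := translationMatrix_mem_positiveMultiples
      (Subgroup.subset_closure (by simp) : tGL ∈ Subgroup.closure {tGL, hGL}) ht'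
    have hF := coe_mem_positiveMultiples
      (Subgroup.subset_closure (by simp) : hGL ∈ Subgroup.closure {tGL, hGL})
    rw [hh'] at hF
    obtain ⟨c, hc⟩ := (ZMod.intCast_zmod_eq_zero_iff_dvd _ _).mp
      (CongruenceSubgroup.Gamma0_mem.mp hg)
    have hdet := g.det_coe
    rw [Matrix.det_fin_two, hc] at hdet
    have hmem := mem_positiveMultiples_of_le_four hN hN4 hT hF _ _ c _ hdet
    have hg' : (g : Matrix (Fin 2) (Fin 2) ℤ).map (fun m : ℤ => (m : ℝ)) =
        !![(g 0 0 : ℝ), g 0 1; N * c, g 1 1] := by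
      ext i j
      fin_cases i <;> fin_cases j <;> simp [hc]
    rwa [← hg'] at hmem
end
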